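/- Let α be an expansive partition of exponent θ ≥ 0 that is eventually decreasing. Then dim_H(F_∞^(α)) = dim_H(G_∞^(α)) = 1/(1+θ), where G_∞^(α) is the set of x whose α-Lüroth digits tend to infinity, and F_∞^(α) ⊂ G_∞^(α) additionally requires the digit sequence to be non-decreasing. -/

import Mathlib

open Filter Set MeasureTheory Topology

noncomputable section

/-- Data of a countable interval partition `α` of `(0,1]`: `a n` is the Lebesgue
measure of the `n`-th atom `A_n` (for `n ≥ 1`), the atoms are ordered from right
to left and their measures sum to `1`. -/
structure LurothData where
  a : ℕ → ℝ
  pos : ∀ n, 1 ≤ n → 0 < a n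
  summ : Summable fun n => a (n + 1)
  total : (∑' n : ℕ, a (n + 1)) = 1

namespace LurothData

variable (P : LurothData)

/-- the `n`-th tail `t_n = Σ_{k ≥ n} a_k`. -/
def t (n : ℕ) : ℝ := ∑' k : ℕ, P.a (n + k)

/-- the index `n` of the atom `A_n = (t_{n+1}, t_n]` containing `x` (and `0` if none). -/
def digit (x : ℝ) : ℕ := sInf {n | 1 ≤ n ∧ x ∈ Set.Ioc (P.t (n + 1)) (P.t n)}

/-- the α-Lüroth map `L_α`. -/
def map (x : ℝ) : ℝ :=
  if P.digit x = 0 then 0 else (P.t (P.digit x) - x) / P.a (P.digit x)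

/-- `dseq P n x` is the `(n+1)`-st α-Lüroth digit `ℓ_{n+1}(x)`. -/
def dseq (n : ℕ) (x : ℝ) : ℕ := P.digit (P.map^[n] x)

/-- the finite α-Lüroth expansion `[ℓ_1, …, ℓ_k]_α`. -/
def val : List ℕ → ℝ
  | [] => 0
  | l :: ls => P.t l - P.a l * val ls

/-- the α-Lüroth cylinder set `C_α(ℓ_1, …, ℓ_k)` (as the set of points whose
first `k` digits are prescribed). -/
def cyl (ls : List ℕ) : Set ℝ :=
  {x | x ∈ Set.Ioc (0 : ℝ) 1 ∧ ∀ i : Fin ls.length, P.dseq i x = ls.get i}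

end LurothData

/-- A (discretely sampled) slowly varying function. -/
def SlowlyVaryingN (ψ : ℕ → ℝ) : Prop :=
  ∀ c : ℕ, 0 < c → Tendsto (fun n => ψ (c * n) / ψ n) atTop (𝓝 1)

/-- `α` is expansive of exponent `θ`: `t_n = ψ(n) n^{-θ}` with `ψ` slowly varying. -/
def LurothData.Expansive (P : LurothData) (θ : ℝ) : Prop :=
  ∃ ψ : ℕ → ℝ, (∀ n, 0 < ψ n) ∧ SlowlyVaryingN ψ ∧
    ∀ n, 1 ≤ n → P.t n = ψ n * (n : ℝ) ^ (-θ)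

/-- `α` is eventually decreasing. -/
def LurothData.EventuallyDecreasing (P : LurothData) : Prop :=
  ∃ N : ℕ, ∀ n, N ≤ n → P.a (n + 1) < P.a n

/-- the α-Good set `G_N^{(α)}`. -/
def LurothData.goodSet (P : LurothData) (N : ℕ) : Set ℝ :=
  {x | x ∈ Set.Ioc (0 : ℝ) 1 ∧ ∀ n : ℕ, N < P.dseq n x}

/-- `G_∞^{(α)}`: points whose digits tend to infinity. -/
def LurothData.Ginf (P : LurothData) : Set ℝ :=
  {x | x ∈ Set.Ioc (0 : ℝ) 1 ∧ Tendsto (fun n => P.dseq n x) atTop atTop}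

/-- `F_∞^{(α)}`: points whose digits are non-decreasing and tend to infinity. -/
def LurothData.Finf (P : LurothData) : Set ℝ :=
  {x | x ∈ P.Ginf ∧ ∀ n : ℕ, P.dseq n x ≤ P.dseq (n + 1) x}

end

namespace LurothData

section Tails

variable (P : LurothData)

lemma summable_tail {n : ℕ} (hn : 1 ≤ n) : Summable fun k => P.a (n + k) := by
  obtain ⟨m, rfl⟩ := Nat.exists_eq_add_of_le' hn
  have h := (summable_nat_add_iff (f := fun n => P.a (n + 1)) m).2 P.summ
  refine h.congr fun k => ?_
  congr 1
  omega

lemma t_eq_add {n : ℕ} (hn : 1 ≤ n) : P.t n = P.a n + P.t (n + 1) := by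
  unfold t
  rw [(P.summable_tail hn).tsum_eq_zero_add]
  congr 1
  refine tsum_congr fun k => ?_
  congr 1
  omega

lemma t_pos {n : ℕ} (hn : 1 ≤ n) : 0 < P.t n :=
  (P.summable_tail hn).tsum_pos (fun k => (P.pos _ (by omega)).le) 0 (P.pos _ (by omega))

lemma t_one : P.t 1 = 1 := by
  rw [← P.total]
  exact tsum_congr fun k => by rw [add_comm]

lemma t_anti {m n : ℕ} (hm : 1 ≤ m) (hmn : m ≤ n) : P.t n ≤ P.t m := by
  induction n, hmn using Nat.le_induction with
  | base => exact le_rfl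
  | succ n hn ih =>
    have h1 := P.t_eq_add (hm.trans hn)
    have h2 := P.pos n (hm.trans hn)
    linarith

lemma t_le_one {n : ℕ} (hn : 1 ≤ n) : P.t n ≤ 1 := P.t_one ▸ P.t_anti le_rfl hn

lemma a_le_t {n : ℕ} (hn : 1 ≤ n) : P.a n ≤ P.t n := by
  have h1 := P.t_eq_add hn
  have h2 := P.t_pos (n := n + 1) (by omega)
  linarith

lemma t_tendsto : Tendsto P.t atTop (𝓝 0) := by
  rw [← tendsto_add_atTop_iff_nat 1]
  refine (tendsto_sum_nat_add fun n => P.a (n + 1)).congr fun n => ?_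
  refine tsum_congr fun k => ?_
  congr 1
  omega

lemma digit_spec {x : ℝ} (h : P.digit x ≠ 0) :
    1 ≤ P.digit x ∧ x ∈ Set.Ioc (P.t (P.digit x + 1)) (P.t (P.digit x)) :=
  Nat.sInf_mem (Nat.nonempty_of_pos_sInf (Nat.pos_of_ne_zero h))

lemma digit_eq {x : ℝ} {n : ℕ} (hn : 1 ≤ n) (hx : x ∈ Set.Ioc (P.t (n + 1)) (P.t n)) :
    P.digit x = n := by
  have hmem : n ∈ {n | 1 ≤ n ∧ x ∈ Set.Ioc (P.t (n + 1)) (P.t n)} := ⟨hn, hx⟩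
  have hle : P.digit x ≤ n := Nat.sInf_le hmem
  obtain ⟨h1, h2⟩ := Nat.sInf_mem ⟨n, hmem⟩
  refine hle.antisymm (le_of_not_gt fun hlt => ?_)
  have := P.t_anti (m := P.digit x + 1) (n := n) (by omega) hlt
  have h3 : P.t (P.digit x + 1) < x := h2.1
  linarith [hx.2]

lemma digit_zero : P.digit 0 = 0 := by
  by_contra h
  have := (P.digit_spec h).2.1
  linarith [P.t_pos (n := P.digit 0 + 1) (by omega)]

lemma map_zero : P.map 0 = 0 := by simp [map, P.digit_zero]

lemma dseq_zero_right (n : ℕ) : P.dseq n 0 = 0 := by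
  rw [dseq, Function.iterate_fixed P.map_zero, P.digit_zero]

lemma dseq_succ (n : ℕ) (x : ℝ) : P.dseq (n + 1) x = P.dseq n (P.map x) := by
  simp [dseq]

lemma eq_of_digit_ne_zero {x : ℝ} (h : P.digit x ≠ 0) :
    x = P.t (P.digit x) - P.a (P.digit x) * P.map x := by
  have := P.pos _ (P.digit_spec h).1
  simp only [map, h, if_false]
  field_simp
  ring

end Tails

section Growth

variable {P : LurothData} {θ : ℝ}

lemma Expansive.tendsto_ratio (h : P.Expansive θ) :
    Tendsto (fun n => P.t (2 * n) / P.t n) atTop (𝓝 ((2 : ℝ) ^ (-θ))) := by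
  obtain ⟨ψ, hpos, hψ, ht⟩ := h
  have := (hψ 2 two_pos).mul_const ((2 : ℝ) ^ (-θ))
  rw [one_mul] at this
  refine this.congr' ?_
  filter_upwards [eventually_ge_atTop 1] with n hn
  have hn' : (0 : ℝ) < n := by exact_mod_cast hn
  have h1 := Real.rpow_pos_of_pos hn' (-θ)
  have h2 := hpos n
  rw [ht n hn, ht (2 * n) (by omega)]
  push_cast
  rw [Real.mul_rpow two_pos.le hn'.le]
  field_simp

lemma Expansive.exists_le_mul_t_two_mul (h : P.Expansive θ) :
    ∃ C : ℝ, 1 ≤ C ∧ ∀ n, 1 ≤ n → P.t n ≤ C * P.t (2 * n) := by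
  have h1 := h.tendsto_ratio.inv₀ (Real.rpow_pos_of_pos two_pos _).ne'
  obtain ⟨C, hC⟩ := h1.bddAbove_range
  refine ⟨max C 1, le_max_right _ _, fun n hn => ?_⟩
  have h2 : (P.t (2 * n) / P.t n)⁻¹ ≤ C := hC ⟨n, rfl⟩
  have h3 := P.t_pos (n := 2 * n) (by omega)
  rw [inv_div, div_le_iff₀ h3] at h2
  exact h2.trans (mul_le_mul_of_nonneg_right (le_max_left _ _) h3.le)

lemma Expansive.exists_lower (h : P.Expansive θ) {η : ℝ} (hη : θ < η) (hη0 : 0 < η) :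
    ∃ c : ℝ, 0 < c ∧ ∀ n : ℕ, 1 ≤ n → c * (n : ℝ) ^ (-η) ≤ P.t n := by
  have h1 : (2 : ℝ) ^ (-η) < 2 ^ (-θ) := Real.rpow_lt_rpow_of_exponent_lt one_lt_two (by linarith)
  obtain ⟨N, hN⟩ := eventually_atTop.1
    ((h.tendsto_ratio.eventually_const_lt h1).and (eventually_ge_atTop 1))
  have hN1 : 1 ≤ N := (hN N le_rfl).2
  have h2 : (0 : ℝ) < 2 ^ (-η) := Real.rpow_pos_of_pos two_pos _
  have key : ∀ k : ℕ, ((2 : ℝ) ^ (-η)) ^ k * P.t N ≤ P.t (2 ^ k * N) := by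
    intro k
    induction k with
    | zero => simp
    | succ k ih =>
      have hk : N ≤ 2 ^ k * N := Nat.le_mul_of_pos_left _ (by positivity)
      have h3 := (hN _ hk).1
      have h4 := P.t_pos (hN1.trans hk)
      rw [lt_div_iff₀ h4, ← mul_assoc, ← pow_succ'] at h3
      calc _ = (2 : ℝ) ^ (-η) * (((2 : ℝ) ^ (-η)) ^ k * P.t N) := by ring
        _ ≤ (2 : ℝ) ^ (-η) * P.t (2 ^ k * N) := by gcongr
        _ ≤ _ := h3.le
  refine ⟨2 ^ (-η) * P.t N, mul_pos h2 (P.t_pos hN1), fun n hn => ?_⟩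
  have hn' : (0 : ℝ) < n := by exact_mod_cast hn
  have h5 : 2 ^ Nat.log 2 n ≤ n := Nat.pow_log_le_self 2 (by omega)
  have h6 : n < 2 ^ (Nat.log 2 n + 1) := Nat.lt_pow_succ_log_self one_lt_two n
  have h7 : n ≤ 2 ^ (Nat.log 2 n + 1) * N := h6.le.trans (Nat.le_mul_of_pos_right _ hN1)
  have h8 : (n : ℝ) ^ (-η) ≤ ((2 : ℝ) ^ (-η)) ^ Nat.log 2 n := by
    rw [← Real.rpow_natCast, ← Real.rpow_mul two_pos.le, mul_comm, Real.rpow_mul two_pos.le,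
      Real.rpow_natCast]
    exact Real.rpow_le_rpow_of_nonpos (by positivity) (by exact_mod_cast h5) (by linarith)
  calc _ = 2 ^ (-η) * (n : ℝ) ^ (-η) * P.t N := by ring
    _ ≤ 2 ^ (-η) * ((2 : ℝ) ^ (-η)) ^ Nat.log 2 n * P.t N := by
      have := (P.t_pos hN1).le
      gcongr
    _ = ((2 : ℝ) ^ (-η)) ^ (Nat.log 2 n + 1) * P.t N := by ring
    _ ≤ _ := key _
    _ ≤ _ := P.t_anti hn h7

lemma Expansive.exists_upper (h : P.Expansive θ) {η : ℝ} (hη : η < θ) (hη0 : 0 ≤ η) :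
    ∃ C : ℝ, 0 < C ∧ ∀ᶠ n : ℕ in atTop, P.t n ≤ C * (n : ℝ) ^ (-η) := by
  have h1 : (2 : ℝ) ^ (-θ) < 2 ^ (-η) := Real.rpow_lt_rpow_of_exponent_lt one_lt_two (by linarith)
  obtain ⟨N, hN⟩ := eventually_atTop.1
    ((h.tendsto_ratio.eventually_lt_const h1).and (eventually_ge_atTop 1))
  have hN1 : 1 ≤ N := (hN N le_rfl).2
  have hN' : (0 : ℝ) < N := by exact_mod_cast hN1
  have h2 : (0 : ℝ) < 2 ^ (-η) := Real.rpow_pos_of_pos two_pos _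
  have key : ∀ k : ℕ, P.t (2 ^ k * N) ≤ ((2 : ℝ) ^ (-η)) ^ k * P.t N := by
    intro k
    induction k with
    | zero => simp
    | succ k ih =>
      have hk : N ≤ 2 ^ k * N := Nat.le_mul_of_pos_left _ (by positivity)
      have h3 := (hN _ hk).1
      have h4 := P.t_pos (hN1.trans hk)
      rw [div_lt_iff₀ h4, ← mul_assoc, ← pow_succ'] at h3
      calc _ ≤ (2 : ℝ) ^ (-η) * P.t (2 ^ k * N) := h3.le
        _ ≤ (2 : ℝ) ^ (-η) * (((2 : ℝ) ^ (-η)) ^ k * P.t N) := by gcongr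
        _ = _ := by ring
  have h0 : (0 : ℝ) < (2 * N : ℝ)⁻¹ ^ (-η) := Real.rpow_pos_of_pos (by positivity) _
  refine ⟨(2 * N : ℝ)⁻¹ ^ (-η) * P.t N, mul_pos h0 (P.t_pos hN1), ?_⟩
  filter_upwards [eventually_ge_atTop N] with n hn
  have hn' : (0 : ℝ) < n := by exact_mod_cast hN1.trans hn
  set k := Nat.log 2 (n / N) with hk
  have hq : n / N ≠ 0 := (Nat.div_pos hn hN1).ne'
  have h5 : 2 ^ k * N ≤ n :=
    (Nat.mul_le_mul_right _ (Nat.pow_log_le_self 2 hq)).trans (Nat.div_mul_le_self n N)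
  have h6 : n < 2 ^ (k + 1) * N :=
    (Nat.div_lt_iff_lt_mul hN1).1 (Nat.lt_pow_succ_log_self one_lt_two _)
  have h8 : ((2 : ℝ) ^ (-η)) ^ k ≤ ((2 * N : ℝ)⁻¹ * n) ^ (-η) := by
    rw [← Real.rpow_natCast, ← Real.rpow_mul two_pos.le, mul_comm, Real.rpow_mul two_pos.le,
      Real.rpow_natCast]
    refine Real.rpow_le_rpow_of_nonpos (by positivity) ?_ (by linarith)
    rw [inv_mul_le_iff₀ (by positivity)]
    have : (n : ℝ) ≤ 2 ^ (k + 1) * N := by exact_mod_cast h6.le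
    calc (n : ℝ) ≤ _ := this
      _ = _ := by ring
  calc P.t n ≤ P.t (2 ^ k * N) := P.t_anti (Nat.mul_pos (by positivity) hN1) h5
    _ ≤ _ := key k
    _ ≤ ((2 * N : ℝ)⁻¹ * n) ^ (-η) * P.t N := by
      have := (P.t_pos hN1).le
      gcongr
    _ = _ := by
      rw [Real.mul_rpow (by positivity) hn'.le]
      ring

lemma EventuallyDecreasing.exists_a_mul_le (hdec : P.EventuallyDecreasing) (h : P.Expansive θ) :
    ∃ C : ℝ, 0 < C ∧ ∀ n : ℕ, 1 ≤ n → P.a n * n ≤ C * P.t n := by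
  obtain ⟨N, hN⟩ := hdec
  obtain ⟨C, hC1, hC⟩ := h.exists_le_mul_t_two_mul
  refine ⟨2 * C ^ 2 + (2 * N + 2), by positivity, fun n hn => ?_⟩
  have htn := P.t_pos hn
  rcases lt_or_ge n (2 * N + 2) with hlt | hge
  · have h1 : (n : ℝ) ≤ 2 * N + 2 := by exact_mod_cast hlt.le
    have h2 := P.a_le_t hn
    calc P.a n * n ≤ P.t n * (2 * N + 2) := by gcongr
      _ ≤ _ := by nlinarith [sq_nonneg C]
  · obtain ⟨j, hj⟩ : ∃ j, j = n / 2 := ⟨_, rfl⟩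
    have hj1 : 1 ≤ j := by omega
    have key : ∀ m, j ≤ m → ((m : ℝ) - j) * P.a m ≤ P.t j - P.t m := by
      intro m hm
      induction m, hm using Nat.le_induction with
      | base => simp
      | succ m hm ih =>
        have h1 := hN m (by omega)
        have h2 := P.t_eq_add (hj1.trans hm)
        have h3 : (j : ℝ) ≤ m := by exact_mod_cast hm
        push_cast
        nlinarith
    have h1 := key n (by omega)
    have h2 : P.t j ≤ C * (C * P.t n) := by
      refine (hC j hj1).trans ?_
      gcongr
      refine (hC (2 * j) (by omega)).trans ?_
      gcongr
      exact P.t_anti hn (by omega)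
    have h3 : (2 * j : ℝ) ≤ n := by
      have : 2 * j ≤ n := by omega
      exact_mod_cast this
    have h4 := P.pos n hn
    have h5 : P.a n * n ≤ 2 * (((n : ℝ) - j) * P.a n) := by nlinarith
    have h6 : 0 ≤ (2 * N + 2 : ℝ) * P.t n := by positivity
    nlinarith

end Growth

end LurothData

namespace LurothData

section UpperBound

variable (P : LurothData)

lemma exists_cover {N : ℕ} {s : ℝ} (hs : 0 < s) (hhalf : ∀ n, N < n → P.a n ≤ 1 / 2)
    (hsum : ∑' n : ℕ, ENNReal.ofReal (P.a (N + 1 + n)) ^ s ≤ 1) (k : ℕ) :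
    ∃ T : ℕ → Set ℝ, {x | ∀ n, N < P.dseq n x} ⊆ ⋃ i, T i ∧
      (∀ i, Metric.ediam (T i) ≤ ENNReal.ofReal ((1 / 2) ^ k)) ∧
      ∑' i, Metric.ediam (T i) ^ s ≤ 1 := by
  induction k with
  | zero =>
    refine ⟨fun i => if i = 0 then Icc 0 1 else ∅, fun x hx => ?_, fun i => ?_, ?_⟩
    · have h0 : P.digit x ≠ 0 := (Nat.zero_lt_of_lt (hx 0)).ne'
      obtain ⟨h1, h2, h3⟩ := P.digit_spec h0
      refine mem_iUnion.2 ⟨0, ?_⟩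
      simp only [if_true]
      exact ⟨((P.t_pos (by omega)).trans h2).le, h3.trans (P.t_le_one h1)⟩
    · by_cases hi : i = 0 <;> simp [hi, Real.ediam_Icc]
    · rw [tsum_eq_single 0]
      · simp [Real.ediam_Icc]
      · intro i hi
        simp [hi, hs]
  | succ k ih =>
    obtain ⟨T, hT, hd, hS⟩ := ih
    have hlip : ∀ n, LipschitzWith (Real.toNNReal (P.a (N + 1 + n)))
        (fun y : ℝ => P.t (N + 1 + n) - P.a (N + 1 + n) * y) := by
      intro n
      refine LipschitzWith.of_dist_le_mul fun x y => ?_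
      have hp := (P.pos (N + 1 + n) (by omega)).le
      rw [Real.coe_toNNReal _ hp, Real.dist_eq, Real.dist_eq, ← abs_of_nonneg hp, ← abs_mul,
        abs_of_nonneg hp, ← abs_neg]
      exact le_of_eq (congrArg _ (by ring))
    have hdiam : ∀ n i, Metric.ediam
        ((fun y : ℝ => P.t (N + 1 + n) - P.a (N + 1 + n) * y) '' T i) ≤
        ENNReal.ofReal (P.a (N + 1 + n)) * Metric.ediam (T i) :=
      fun n i => (hlip n).ediam_image_le _
    refine ⟨fun j => (fun y : ℝ => P.t (N + 1 + (Nat.unpair j).1) -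
      P.a (N + 1 + (Nat.unpair j).1) * y) '' T (Nat.unpair j).2, fun x hx => ?_, fun j => ?_, ?_⟩
    · have h0 : P.digit x ≠ 0 := (Nat.zero_lt_of_lt (hx 0)).ne'
      have h1 : P.map x ∈ {x | ∀ n, N < P.dseq n x} := fun n => by
        rw [← P.dseq_succ]
        exact hx _
      obtain ⟨i, hi⟩ := mem_iUnion.1 (hT h1)
      have hN : N < P.digit x := hx 0
      refine mem_iUnion.2 ⟨Nat.pair (P.digit x - (N + 1)) i, P.map x, ?_, ?_⟩
      · simpa using hi
      · simp only [Nat.unpair_pair]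
        rw [Nat.add_sub_of_le hN]
        exact (P.eq_of_digit_ne_zero h0).symm
    · refine (hdiam _ _).trans ?_
      rw [pow_succ', ENNReal.ofReal_mul (by norm_num)]
      gcongr
      · exact hhalf _ (by omega)
      · exact hd _
    · calc _ ≤ ∑' j : ℕ, (ENNReal.ofReal (P.a (N + 1 + (Nat.unpair j).1)) *
              Metric.ediam (T (Nat.unpair j).2)) ^ s :=
            ENNReal.tsum_le_tsum fun j => ENNReal.rpow_le_rpow (hdiam _ _) hs.le
        _ = ∑' p : ℕ × ℕ, (ENNReal.ofReal (P.a (N + 1 + p.1)) * Metric.ediam (T p.2)) ^ s :=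
            Nat.pairEquiv.symm.tsum_eq (fun p : ℕ × ℕ =>
              (ENNReal.ofReal (P.a (N + 1 + p.1)) * Metric.ediam (T p.2)) ^ s)
        _ = ∑' n : ℕ, ENNReal.ofReal (P.a (N + 1 + n)) ^ s * ∑' i, Metric.ediam (T i) ^ s := by
            rw [ENNReal.tsum_prod']
            refine tsum_congr fun n => ?_
            rw [← ENNReal.tsum_mul_left]
            exact tsum_congr fun i => ENNReal.mul_rpow_of_nonneg _ _ hs.le
        _ ≤ 1 := by
            rw [ENNReal.tsum_mul_right]
            exact mul_le_one' hsum hS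

lemma dimH_forall_lt_dseq_le {N : ℕ} {s : NNReal} (hs : 0 < s)
    (hhalf : ∀ n, N < n → P.a n ≤ 1 / 2)
    (hsum : ∑' n : ℕ, ENNReal.ofReal (P.a (N + 1 + n)) ^ (s : ℝ) ≤ 1) :
    dimH {x | ∀ n, N < P.dseq n x} ≤ s := by
  choose T hT hd hS using P.exists_cover (NNReal.coe_pos.2 hs) hhalf hsum
  refine dimH_le_of_hausdorffMeasure_ne_top (ne_top_of_le_ne_top ENNReal.one_ne_top ?_)
  have hr : Tendsto (fun k : ℕ => ENNReal.ofReal ((1 / 2 : ℝ) ^ k)) atTop (𝓝 0) := by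
    rw [← ENNReal.ofReal_zero]
    exact ENNReal.tendsto_ofReal
      (tendsto_pow_atTop_nhds_zero_of_lt_one (by norm_num) (by norm_num))
  refine (Measure.hausdorffMeasure_le_liminf_tsum (ι := fun _ : ℕ => ℕ) s _ _ hr T
    (Eventually.of_forall hd) (Eventually.of_forall hT)).trans ?_
  exact (liminf_le_liminf (Eventually.of_forall hS)).trans (liminf_const _).le

lemma dimH_forall_ge_lt_dseq_le {N : ℕ} {d : ENNReal}
    (h : dimH {x | ∀ n, N < P.dseq n x} ≤ d) (k : ℕ) :
    dimH {x | ∀ n, k ≤ n → N < P.dseq n x} ≤ d := by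
  induction k with
  | zero => simpa using h
  | succ k ih =>
    have hsub : {x | ∀ n, k + 1 ≤ n → N < P.dseq n x} ⊆
        ⋃ d : ℕ, (fun y : ℝ => P.t d - P.a d * y) '' {x | ∀ n, k ≤ n → N < P.dseq n x} := by
      intro x hx
      have h1 : ∀ n, k ≤ n → N < P.dseq n (P.map x) := fun n hn => by
        rw [← P.dseq_succ]
        exact hx _ (by omega)
      have h0 : P.digit x ≠ 0 := fun h0 => by
        have h2 : P.map x = 0 := by simp [map, h0]
        have h3 := h1 k le_rfl
        rw [h2, P.dseq_zero_right] at h3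
        omega
      exact mem_iUnion.2 ⟨P.digit x, P.map x, h1, (P.eq_of_digit_ne_zero h0).symm⟩
    refine (dimH_mono hsub).trans ?_
    rw [dimH_iUnion]
    refine iSup_le fun d => le_trans ?_ ih
    refine LipschitzWith.dimH_image_le (K := ‖P.a d‖₊) ?_ _
    refine LipschitzWith.of_dist_le_mul fun x y => ?_
    rw [coe_nnnorm, Real.norm_eq_abs, Real.dist_eq, Real.dist_eq, ← abs_mul, ← abs_neg]
    exact le_of_eq (congrArg _ (by ring))

lemma dimH_Ginf_le_of_summable {s : NNReal} (hs : 0 < s)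
    (hsum : Summable fun n => P.a (n + 1) ^ (s : ℝ)) : dimH P.Ginf ≤ s := by
  have ha : Tendsto (fun n => P.a (n + 1)) atTop (𝓝 0) := P.summ.tendsto_atTop_zero
  have h1 : ∀ᶠ N : ℕ in atTop, ∀ n, N < n → P.a n ≤ 1 / 2 := by
    obtain ⟨M, hM⟩ := eventually_atTop.1 (ha.eventually_le_const (u := 1 / 2) (by norm_num))
    filter_upwards [eventually_ge_atTop M] with N hN n hn
    have := hM (n - 1) (by omega)
    rwa [Nat.sub_add_cancel (by omega)] at this
  have h2 : ∀ᶠ N : ℕ in atTop,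
      ∑' n : ℕ, ENNReal.ofReal (P.a (N + 1 + n)) ^ (s : ℝ) ≤ 1 := by
    have h3 := tendsto_sum_nat_add fun n => P.a (n + 1) ^ (s : ℝ)
    filter_upwards [h3.eventually_le_const (u := 1) one_pos] with N hN
    have h4 : ∀ n, ENNReal.ofReal (P.a (N + 1 + n)) ^ (s : ℝ) =
        ENNReal.ofReal (P.a (n + N + 1) ^ (s : ℝ)) := fun n => by
      rw [ENNReal.ofReal_rpow_of_nonneg (P.pos _ (by omega)).le s.coe_nonneg]
      congr 3
      omega
    rw [tsum_congr h4, ← ENNReal.ofReal_tsum_of_nonneg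
      (fun n => Real.rpow_nonneg (P.pos _ (by omega)).le _)
      ((summable_nat_add_iff (f := fun n => P.a (n + 1) ^ (s : ℝ)) N).2 hsum)]
    exact ENNReal.ofReal_le_one.2 hN
  obtain ⟨N, hN1, hN2⟩ := (h1.and h2).exists
  have hsub : P.Ginf ⊆ ⋃ k : ℕ, {x | ∀ n, k ≤ n → N < P.dseq n x} := by
    rintro x ⟨-, hx⟩
    obtain ⟨k, hk⟩ := eventually_atTop.1 (hx.eventually_gt_atTop N)
    exact mem_iUnion.2 ⟨k, hk⟩
  refine (dimH_mono hsub).trans ?_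
  rw [dimH_iUnion]
  exact iSup_le fun k => P.dimH_forall_ge_lt_dseq_le (P.dimH_forall_lt_dseq_le hs hN1 hN2) k

lemma summable_a_rpow {P : LurothData} {θ s : ℝ} (hθ : 0 < θ) (hexp : P.Expansive θ)
    (hdec : P.EventuallyDecreasing) (hs : 1 / (1 + θ) < s) :
    Summable fun n => P.a (n + 1) ^ s := by
  have hs0 : 0 < s := lt_trans (by positivity) hs
  rw [div_lt_iff₀ (by positivity)] at hs
  obtain ⟨η, hη0, hη, hηs⟩ : ∃ η, 0 ≤ η ∧ η < θ ∧ 1 < s * (1 + η) := by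
    obtain ⟨η, h1, h2⟩ := exists_between (show max 0 (1 / s - 1) < θ by
      refine max_lt hθ ?_
      rw [sub_lt_iff_lt_add, div_lt_iff₀ hs0]
      linarith)
    have h3 := (le_max_right _ _).trans_lt h1
    rw [sub_lt_iff_lt_add, div_lt_iff₀ hs0] at h3
    exact ⟨η, (le_max_left _ _).trans h1.le, h2, by linarith⟩
  obtain ⟨C, hC0, hC⟩ := hdec.exists_a_mul_le hexp
  obtain ⟨D, hD0, hD⟩ := hexp.exists_upper hη hη0
  have hbase : Summable fun n : ℕ => (C * D) ^ s * (n : ℝ) ^ (-((1 + η) * s)) := by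
    refine Summable.mul_left _ ?_
    rw [Real.summable_nat_rpow]
    linarith
  have h : Summable fun n => P.a n ^ s := by
    refine Summable.of_norm_bounded_eventually_nat hbase ?_
    filter_upwards [hD, eventually_ge_atTop 1] with n hn hn1
    have hn' : (0 : ℝ) < n := by exact_mod_cast hn1
    have hp := P.pos n hn1
    rw [Real.norm_of_nonneg (Real.rpow_nonneg hp.le _), ← neg_mul, Real.rpow_mul hn'.le,
      ← Real.mul_rpow (by positivity) (by positivity)]
    refine Real.rpow_le_rpow hp.le ?_ hs0.le
    rw [neg_add, Real.rpow_add hn', Real.rpow_neg_one]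
    calc P.a n = P.a n * n * (n : ℝ)⁻¹ := by field_simp
      _ ≤ C * P.t n * (n : ℝ)⁻¹ := by
        exact mul_le_mul_of_nonneg_right (hC n hn1) (by positivity)
      _ ≤ C * (D * (n : ℝ) ^ (-η)) * (n : ℝ)⁻¹ := by gcongr
      _ = _ := by ring
  exact (summable_nat_add_iff (f := fun n => P.a n ^ s) 1).2 h

theorem dimH_Ginf_le {P : LurothData} {θ : ℝ} (hθ : 0 ≤ θ) (hexp : P.Expansive θ)
    (hdec : P.EventuallyDecreasing) : dimH P.Ginf ≤ ENNReal.ofReal (1 / (1 + θ)) := by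
  rcases hθ.eq_or_lt with rfl | hθ
  · simpa using (dimH_mono (subset_univ P.Ginf)).trans Real.dimH_univ.le
  · refine le_of_forall_gt fun d hd => ?_
    obtain ⟨s, hs1, hs2⟩ := ENNReal.lt_iff_exists_nnreal_btwn.1 hd
    refine lt_of_le_of_lt ?_ hs2
    rw [ENNReal.ofReal_lt_coe_iff (by positivity)] at hs1
    have hs0 : (0 : ℝ) < s := lt_trans (by positivity) hs1
    exact P.dimH_Ginf_le_of_summable (NNReal.coe_pos.1 hs0) (summable_a_rpow hθ hexp hdec hs1)

end UpperBound

end LurothData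

namespace LurothData

/-- `m` cuts the digits into consecutive blocks `[m k, m (k + 1))` whose masses and tails decay
like `Q⁻ᵏ`. -/
structure IsBlockSeq (P : LurothData) (Q : ℝ) (m : ℕ → ℕ) : Prop where
  two_le : 2 ≤ Q
  strictMono : StrictMono m
  one_le : ∀ k, 1 ≤ m k
  t_le : ∀ k, P.t (m k) ≤ (Q ^ (k + 1))⁻¹
  le_sub : ∀ k, (Q ^ (k + 2))⁻¹ ≤ P.t (m k) - P.t (m (k + 1))

/-- `ℓ` is a digit sequence with `ℓ k` in the `k`-th block, `x k` is the point whose α-Lüroth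
digits are `ℓ k, ℓ (k + 1), …`, and `y k` is the point with the same digits for the expansions
in which the `k`-th block is rescaled to have total mass one. -/
structure IsCoding (P : LurothData) (m ℓ : ℕ → ℕ) (x y : ℕ → ℝ) : Prop where
  mem_block : ∀ k, ℓ k ∈ Ico (m k) (m (k + 1))
  x_mem : ∀ k, x k ∈ Icc (0 : ℝ) 1
  y_mem : ∀ k, y k ∈ Icc (0 : ℝ) 1
  x_eq : ∀ k, x k = P.t (ℓ k) - P.a (ℓ k) * x (k + 1)
  y_eq : ∀ k, (P.t (m k) - P.t (m (k + 1))) * y k =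
    P.t (ℓ k) - P.t (m (k + 1)) - P.a (ℓ k) * y (k + 1)

section Existence

variable (P : LurothData)

lemma Expansive.exists_isBlockSeq {P : LurothData} {θ : ℝ} (h : P.Expansive θ) :
    ∃ Q m, P.IsBlockSeq Q m := by
  obtain ⟨C, hC1, hC⟩ := h.exists_le_mul_t_two_mul
  have hQ : (2 : ℝ) ≤ 2 * C := by linarith
  have hex : ∀ k : ℕ, ∃ n, 1 ≤ n ∧ P.t n ≤ ((2 * C) ^ (k + 1))⁻¹ ∧
      ((2 * C) ^ (k + 1))⁻¹ ≤ C * P.t n := by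
    intro k
    have hq0 : 0 < ((2 * C) ^ (k + 1))⁻¹ := by positivity
    have hq1 : ((2 * C) ^ (k + 1))⁻¹ < 1 :=
      inv_lt_one_of_one_lt₀ (one_lt_pow₀ (by linarith) (by omega))
    have hne : ∃ n, P.t (n + 1) ≤ ((2 * C) ^ (k + 1))⁻¹ :=
      ((tendsto_add_atTop_iff_nat 1).2 P.t_tendsto |>.eventually_le_const hq0).exists
    classical
    obtain ⟨n, hn⟩ : ∃ n, n = Nat.find hne := ⟨_, rfl⟩
    have h1 := Nat.find_spec hne
    rw [← hn] at h1
    have hn0 : n ≠ 0 := by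
      rintro rfl
      rw [P.t_one] at h1
      linarith
    have h2 := Nat.find_min hne (m := n - 1) (by omega)
    rw [Nat.sub_add_cancel (by omega), not_le] at h2
    refine ⟨n + 1, by omega, h1, h2.le.trans ((hC n (by omega)).trans ?_)⟩
    gcongr
    exact P.t_anti (by omega) (by omega)
  choose m hm1 hm2 hm3 using hex
  have hsub : ∀ k, ((2 * C) ^ (k + 2))⁻¹ ≤ P.t (m k) - P.t (m (k + 1)) := by
    intro k
    have h1 := hm3 k
    have h2 := hm2 (k + 1)
    have h3 : ((2 * C) ^ (k + 1))⁻¹ = 2 * C * ((2 * C) ^ (k + 2))⁻¹ := by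
      field_simp
      ring
    rw [h3] at h1
    have h4 : 2 * ((2 * C) ^ (k + 2))⁻¹ ≤ P.t (m k) := by
      refine le_of_mul_le_mul_left (a := C) ?_ (by linarith)
      linarith
    linarith [h2]
  refine ⟨2 * C, m, hQ, strictMono_nat_of_lt_succ fun k => ?_, hm1, hm2, hsub⟩
  by_contra! hle
  have h1 := P.t_anti (hm1 _) hle
  have h2 : 0 < ((2 * C) ^ (k + 2))⁻¹ := by positivity
  linarith [hsub k]

lemma sub_mul_mem_Icc {n : ℕ} (hn : 1 ≤ n) {x : ℝ} (hx : x ∈ Icc (0 : ℝ) 1) :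
    P.t n - P.a n * x ∈ Icc (P.t (n + 1)) (P.t n) := by
  have h1 := P.t_eq_add hn
  have h2 := P.pos n hn
  constructor <;> nlinarith [hx.1, hx.2]

lemma exists_partial_orbit (n : ℕ) (ℓ : ℕ → ℕ) (hℓ : ∀ i, 1 ≤ ℓ i) :
    ∃ x : ℕ → ℝ, (∀ j, x j ∈ Icc (0 : ℝ) 1) ∧
      ∀ j < n, x j = P.t (ℓ j) - P.a (ℓ j) * x (j + 1) := by
  induction n generalizing ℓ with
  | zero => exact ⟨fun _ => 0, fun _ => ⟨le_rfl, zero_le_one⟩, fun j hj => absurd hj (by omega)⟩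
  | succ n ih =>
    obtain ⟨x, hx, hx'⟩ := ih (fun j => ℓ (j + 1)) (fun j => hℓ _)
    refine ⟨fun j => Nat.casesOn j (P.t (ℓ 0) - P.a (ℓ 0) * x 0) x, ?_, ?_⟩
    · rintro (_ | j)
      · have := P.sub_mul_mem_Icc (hℓ 0) (hx 0)
        exact ⟨(P.t_pos (by omega)).le.trans this.1, this.2.trans (P.t_le_one (hℓ 0))⟩
      · exact hx j
    · rintro (_ | j) hj
      · rfl
      · exact hx' j (by omega)

lemma exists_orbit (ℓ : ℕ → ℕ) (hℓ : ∀ i, 1 ≤ ℓ i) :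
    ∃ x : ℕ → ℝ, (∀ j, x j ∈ Icc (0 : ℝ) 1) ∧
      ∀ j, x j = P.t (ℓ j) - P.a (ℓ j) * x (j + 1) := by
  let K : ℕ → Set (ℕ → ℝ) := fun n => Set.pi univ (fun _ => Icc (0 : ℝ) 1) ∩
    {x | ∀ j < n, x j = P.t (ℓ j) - P.a (ℓ j) * x (j + 1)}
  have hcpt : IsCompact (Set.pi univ fun _ : ℕ => Icc (0 : ℝ) 1) :=
    isCompact_univ_pi fun _ => isCompact_Icc
  have hclosed : ∀ n, IsClosed (K n) := by
    intro n
    refine hcpt.isClosed.inter ?_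
    simp only [ofPred_forall]
    exact isClosed_iInter fun j => isClosed_iInter fun _ =>
      isClosed_eq (by fun_prop) (by fun_prop)
  obtain ⟨x, hx⟩ := IsCompact.nonempty_iInter_of_sequence_nonempty_isCompact_isClosed K
    (fun n x hx => ⟨hx.1, fun j hj => hx.2 j (by omega)⟩)
    (fun n => by
      obtain ⟨x, hx, hx'⟩ := P.exists_partial_orbit n ℓ hℓ
      exact ⟨x, fun j _ => hx j, hx'⟩)
    (hcpt.of_isClosed_subset (hclosed 0) inter_subset_left) hclosed
  rw [mem_iInter] at hx
  exact ⟨x, fun j => (hx 0).1 j trivial, fun j => (hx (j + 1)).2 j (by omega)⟩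

lemma exists_mem_atom {i j : ℕ} (hij : i < j) {v : ℝ} (h1 : P.t j ≤ v) (h2 : v ≤ P.t i) :
    ∃ n ∈ Ico i j, P.t (n + 1) ≤ v ∧ v ≤ P.t n := by
  induction j, Nat.succ_le_of_lt hij using Nat.le_induction with
  | base => exact ⟨i, ⟨le_rfl, by omega⟩, h1, h2⟩
  | succ j hj ih =>
    rcases le_total (P.t j) v with h | h
    · obtain ⟨n, hn, hn'⟩ := ih hj h
      exact ⟨n, ⟨hn.1, hn.2.trans (by omega)⟩, hn'⟩
    · exact ⟨j, ⟨by omega, by omega⟩, h1, h⟩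

variable {P} {Q : ℝ} {m : ℕ → ℕ}

lemma IsBlockSeq.sub_nonneg (hm : P.IsBlockSeq Q m) (k : ℕ) :
    0 ≤ P.t (m k) - P.t (m (k + 1)) :=
  _root_.sub_nonneg.2 (P.t_anti (hm.one_le k) (hm.strictMono (Nat.lt_succ_self k)).le)

lemma IsBlockSeq.exists_step (hm : P.IsBlockSeq Q m) (k : ℕ) (y : Icc (0 : ℝ) 1) :
    ∃ ℓ ∈ Ico (m k) (m (k + 1)), ∃ y' : Icc (0 : ℝ) 1,
      (P.t (m k) - P.t (m (k + 1))) * y = P.t ℓ - P.t (m (k + 1)) - P.a ℓ * y' := by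
  obtain ⟨y, hy0, hy1⟩ := y
  have hlt := hm.strictMono (Nat.lt_succ_self k)
  have hW := hm.sub_nonneg k
  obtain ⟨ℓ, hℓ, h1, h2⟩ := P.exists_mem_atom hlt
    (v := (P.t (m k) - P.t (m (k + 1))) * y + P.t (m (k + 1)))
    (by linarith [mul_nonneg hW hy0]) (by linarith [mul_le_of_le_one_right hW hy1])
  have hℓ1 := (hm.one_le k).trans hℓ.1
  have ha := P.pos ℓ hℓ1
  have ht := P.t_eq_add hℓ1
  refine ⟨ℓ, hℓ, ⟨(P.t ℓ - ((P.t (m k) - P.t (m (k + 1))) * y + P.t (m (k + 1)))) / P.a ℓ,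
    div_nonneg (by linarith) ha.le, (div_le_one ha).2 (by linarith)⟩, ?_⟩
  simp only
  rw [mul_div_cancel₀ _ ha.ne']
  ring

lemma IsBlockSeq.exists_isCoding (hm : P.IsBlockSeq Q m) {y₀ : ℝ} (hy₀ : y₀ ∈ Icc (0 : ℝ) 1) :
    ∃ ℓ x y, P.IsCoding m ℓ x y ∧ y 0 = y₀ := by
  choose L hL Y hY using hm.exists_step
  let y : ℕ → Icc (0 : ℝ) 1 := fun n => Nat.rec ⟨y₀, hy₀⟩ (fun k z => Y k z) n
  obtain ⟨x, hx, hx'⟩ := P.exists_orbit (fun k => L k (y k))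
    fun k => (hm.one_le k).trans (hL k (y k)).1
  refine ⟨fun k => L k (y k), x, fun k => (y k).1, ⟨fun k => hL k (y k), hx,
    fun k => (y k).2, hx', fun k => hY k (y k)⟩, ?_⟩
  rfl

end Existence

section Coding

variable {P : LurothData} {Q : ℝ} {m ℓ ℓ' : ℕ → ℕ} {x x' y y' : ℕ → ℝ}

lemma IsCoding.x_mem_Ioo (hm : P.IsBlockSeq Q m) (h : P.IsCoding m ℓ x y) (k : ℕ) :
    x k ∈ Ioo (P.t (ℓ k + 1)) (P.t (ℓ k)) := by
  have h1 : ∀ k, 1 ≤ ℓ k := fun k => (hm.one_le k).trans (h.mem_block k).1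
  have hpos : ∀ k, 0 < x k := fun k => by
    rw [h.x_eq k]
    exact (P.t_pos (by omega)).trans_le (P.sub_mul_mem_Icc (h1 k) (h.x_mem _)).1
  have hlt : ∀ k, x k < P.t (ℓ k) := fun k => by
    rw [h.x_eq k]
    have := mul_pos (P.pos _ (h1 k)) (hpos (k + 1))
    linarith
  refine ⟨?_, hlt k⟩
  have h2 := (hlt (k + 1)).trans_le (P.t_le_one (h1 _))
  have h3 := P.pos _ (h1 k)
  rw [h.x_eq k]
  nlinarith [P.t_eq_add (h1 k)]

lemma IsCoding.mem_Finf (hm : P.IsBlockSeq Q m) (h : P.IsCoding m ℓ x y) : x 0 ∈ P.Finf := by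
  have h1 : ∀ k, 1 ≤ ℓ k := fun k => (hm.one_le k).trans (h.mem_block k).1
  have hdig : ∀ k, P.digit (x k) = ℓ k := fun k =>
    P.digit_eq (h1 k) (Ioo_subset_Ioc_self (h.x_mem_Ioo hm k))
  have hmap : ∀ k, P.map (x k) = x (k + 1) := fun k => by
    have h0 := h1 k
    have h2 := P.pos _ h0
    rw [map, if_neg (by rw [hdig k]; omega), hdig k, div_eq_iff h2.ne']
    have := h.x_eq k
    linarith
  have hiter : ∀ k, P.map^[k] (x 0) = x k := fun k => by
    induction k with
    | zero => rfl
    | succ k ih => rw [Function.iterate_succ_apply', ih, hmap]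
  have hd : ∀ k, P.dseq k (x 0) = ℓ k := fun k => by rw [dseq, hiter, hdig]
  have h0 := h.x_mem_Ioo hm 0
  refine ⟨⟨⟨(P.t_pos (by omega)).trans h0.1, (h.x_mem 0).2⟩, ?_⟩, fun n => ?_⟩
  · simp only [hd]
    exact tendsto_atTop_mono (fun n => (h.mem_block n).1) hm.strictMono.tendsto_atTop
  · rw [hd, hd]
    exact (h.mem_block n).2.le.trans (h.mem_block (n + 1)).1

lemma IsCoding.abs_sub_eq (h : P.IsCoding m ℓ x y) (h' : P.IsCoding m ℓ' x' y')
    (hm : P.IsBlockSeq Q m) (k : ℕ) (hk : ∀ i < k, ℓ i = ℓ' i) :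
    |x 0 - x' 0| = (∏ i ∈ Finset.range k, P.a (ℓ i)) * |x k - x' k| ∧
    (∏ i ∈ Finset.range k, (P.t (m i) - P.t (m (i + 1)))) * |y 0 - y' 0| =
      (∏ i ∈ Finset.range k, P.a (ℓ i)) * |y k - y' k| := by
  induction k with
  | zero => simp
  | succ k ih =>
    obtain ⟨h1, h2⟩ := ih fun i hi => hk i (by omega)
    have hp := P.pos _ ((hm.one_le k).trans (h.mem_block k).1)
    have hW := hm.sub_nonneg k
    have hkk := hk k (by omega)
    have e1 : |x k - x' k| = P.a (ℓ k) * |x (k + 1) - x' (k + 1)| := by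
      rw [h.x_eq k, h'.x_eq k, ← hkk, ← abs_of_pos hp, ← abs_mul, abs_of_pos hp, ← abs_neg]
      exact congrArg _ (by ring)
    have e2 : (P.t (m k) - P.t (m (k + 1))) * |y k - y' k| =
        P.a (ℓ k) * |y (k + 1) - y' (k + 1)| := by
      have hy := h.y_eq k
      have hy' := h'.y_eq k
      rw [← hkk] at hy'
      rw [← abs_of_nonneg hW, ← abs_of_pos hp, ← abs_mul, ← abs_mul, ← abs_neg]
      refine congrArg _ ?_
      rw [mul_sub, hy, hy']
      ring
    rw [Finset.prod_range_succ, Finset.prod_range_succ]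
    constructor
    · rw [h1, e1]
      ring
    · calc _ = (P.t (m k) - P.t (m (k + 1))) *
            ((∏ i ∈ Finset.range k, (P.t (m i) - P.t (m (i + 1)))) * |y 0 - y' 0|) := by ring
        _ = (∏ i ∈ Finset.range k, P.a (ℓ i)) *
            ((P.t (m k) - P.t (m (k + 1))) * |y k - y' k|) := by rw [h2]; ring
        _ = _ := by rw [e2]; ring

lemma IsCoding.abs_sub_le_of_lt (h : P.IsCoding m ℓ x y) (h' : P.IsCoding m ℓ' x' y')
    (hm : P.IsBlockSeq Q m) {k : ℕ} (hk : ℓ k < ℓ' k) :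
    (P.t (m k) - P.t (m (k + 1))) * |y k - y' k| ≤ Q ^ (k + 4) * |x k - x' k| := by
  have hQ := hm.two_le
  have hW := hm.sub_nonneg k
  have hℓ := (hm.one_le k).trans (h.mem_block k).1
  have hℓ' := (hm.one_le k).trans (h'.mem_block k).1
  have ha := P.pos _ hℓ
  have ha' := P.pos _ hℓ'
  have hQ2 : 2 ≤ Q ^ (k + 4) := hQ.trans (le_self_pow₀ (by linarith) (by omega))
  have hx' : 1 ≤ Q ^ (k + 4) * x' (k + 1) := by
    have h1 : (Q ^ (k + 4))⁻¹ ≤ P.t (m (k + 2)) := by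
      have := hm.le_sub (k + 2)
      have := P.t_pos (hm.one_le (k + 2 + 1))
      linarith
    have h2 := P.t_anti (m := ℓ' (k + 1) + 1) (by omega) (h'.mem_block (k + 1)).2
    have h3 := (h'.x_mem_Ioo hm (k + 1)).1
    rw [← inv_le_iff_one_le_mul₀' (by positivity)]
    exact h1.trans (h2.trans h3.le)
  have hx : 1 ≤ Q ^ (k + 4) * (1 - x (k + 1)) := by
    have h1 := (h.x_mem_Ioo hm (k + 1)).2.trans_le
      ((P.t_anti (hm.one_le _) (h.mem_block (k + 1)).1).trans (hm.t_le (k + 1)))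
    have h2 : (Q ^ (k + 1 + 1))⁻¹ ≤ 2⁻¹ :=
      inv_anti₀ two_pos (hQ.trans (le_self_pow₀ (by linarith) (by omega)))
    nlinarith
  have hD := sub_nonneg.2 (P.t_anti (m := ℓ k + 1) (by omega) hk)
  have hxx : x k - x' k = (P.t (ℓ k + 1) - P.t (ℓ' k)) + P.a (ℓ k) * (1 - x (k + 1)) +
      P.a (ℓ' k) * x' (k + 1) := by
    rw [h.x_eq k, h'.x_eq k, P.t_eq_add hℓ]
    ring
  have hyy : (P.t (m k) - P.t (m (k + 1))) * (y k - y' k) =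
      (P.t (ℓ k + 1) - P.t (ℓ' k)) + P.a (ℓ k) * (1 - y (k + 1)) +
      P.a (ℓ' k) * y' (k + 1) := by
    rw [mul_sub, h.y_eq k, h'.y_eq k, P.t_eq_add hℓ]
    ring
  have h1 := mul_nonneg ha.le (sub_nonneg.2 (h.y_mem (k + 1)).2)
  have h2 := mul_nonneg ha'.le (h'.y_mem (k + 1)).1
  have h3 := mul_le_of_le_one_right ha'.le (h'.y_mem (k + 1)).2
  have h4 := mul_nonneg ha.le (h.y_mem (k + 1)).1
  rw [← abs_of_nonneg hW, ← abs_mul, hyy, abs_of_nonneg (by linarith)]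
  refine le_trans ?_ (mul_le_mul_of_nonneg_left (le_abs_self _) (by positivity))
  rw [hxx]
  have h5 := mul_le_mul_of_nonneg_left hx ha.le
  have h6 := mul_le_mul_of_nonneg_left hx' ha'.le
  have h7 := mul_le_mul_of_nonneg_right hQ2 hD
  nlinarith

lemma IsCoding.abs_sub_le_of_ne (h : P.IsCoding m ℓ x y) (h' : P.IsCoding m ℓ' x' y')
    (hm : P.IsBlockSeq Q m) {k : ℕ} (hk : ℓ k ≠ ℓ' k) :
    (P.t (m k) - P.t (m (k + 1))) * |y k - y' k| ≤ Q ^ (k + 4) * |x k - x' k| := by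
  rcases hk.lt_or_gt with hk | hk
  · exact h.abs_sub_le_of_lt h' hm hk
  · rw [abs_sub_comm, abs_sub_comm (x k)]
    exact h'.abs_sub_le_of_lt h hm hk

lemma IsBlockSeq.le_prod (hm : P.IsBlockSeq Q m) (k : ℕ) :
    1 ≤ (∏ i ∈ Finset.range k, Q ^ (i + 2)) *
      ∏ i ∈ Finset.range k, (P.t (m i) - P.t (m (i + 1))) := by
  have hQ := hm.two_le
  rw [← Finset.prod_mul_distrib]
  refine Finset.one_le_prod fun i => ?_
  rw [← inv_le_iff_one_le_mul₀' (by positivity)]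
  exact fun _ => hm.le_sub i

end Coding

section Estimate

/-- The product of bounds for the lengths of the first `k` atoms, raised to the power `e`, times
the distortion at the first place where two codings differ. -/
noncomputable def codingBound (C Q γ e : ℝ) (k : ℕ) : ℝ :=
  (∏ i ∈ Finset.range k, C * ((Q ^ (i + 1))⁻¹) ^ γ) ^ e *
    (Q ^ (k + 4) * ∏ i ∈ Finset.range (k + 1), Q ^ (i + 2))

lemma codingBound_tendsto {C Q γ e : ℝ} (hC : 0 < C) (hQ : 2 ≤ Q) (hγ : 1 < γ * e) :
    Tendsto (codingBound C Q γ e) atTop (𝓝 0) := by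
  have hQ0 : 0 < Q := by linarith
  have hpos : ∀ k, 0 < codingBound C Q γ e k := fun k => by
    refine mul_pos (Real.rpow_pos_of_pos (Finset.prod_pos fun i _ => ?_) _)
      (mul_pos (by positivity) (Finset.prod_pos fun i _ => by positivity))
    exact mul_pos hC (Real.rpow_pos_of_pos (by positivity) _)
  have hratio : ∀ k, ‖codingBound C Q γ e (k + 1)‖ / ‖codingBound C Q γ e k‖ =
      C ^ e * Q ^ 3 * ((Q ^ (k + 1) : ℝ) ^ (-(γ * e - 1))) := by
    intro k
    have hq : 0 < Q ^ (k + 1) := by positivity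
    have hc : 0 < C * ((Q ^ (k + 1))⁻¹) ^ γ :=
      mul_pos hC (Real.rpow_pos_of_pos (by positivity) _)
    have hp : 0 ≤ ∏ i ∈ Finset.range k, C * ((Q ^ (i + 1))⁻¹) ^ γ :=
      Finset.prod_nonneg fun i _ =>
        (mul_pos hC (Real.rpow_pos_of_pos (by positivity) _)).le
    rw [Real.norm_of_nonneg (hpos _).le, Real.norm_of_nonneg (hpos _).le,
      div_eq_iff (hpos k).ne', codingBound, codingBound,
      Finset.prod_range_succ _ k, Real.mul_rpow hp hc.le, Finset.prod_range_succ _ (k + 1),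
      Real.mul_rpow hC.le (Real.rpow_nonneg (by positivity) _), ← Real.rpow_mul (by positivity),
      Real.inv_rpow hq.le, ← Real.rpow_neg hq.le, neg_sub, sub_eq_add_neg 1,
      Real.rpow_add hq, Real.rpow_one]
    ring
  have hlim : Tendsto (fun k : ℕ => C ^ e * Q ^ 3 * ((Q ^ (k + 1) : ℝ) ^ (-(γ * e - 1))))
      atTop (𝓝 0) := by
    rw [← mul_zero (C ^ e * Q ^ 3)]
    refine Tendsto.const_mul _ ((tendsto_rpow_neg_atTop (sub_pos.2 hγ)).comp ?_)
    exact (tendsto_pow_atTop_atTop_of_one_lt (by linarith)).comp (tendsto_add_atTop_nat 1)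
  refine (summable_of_ratio_test_tendsto_lt_one zero_lt_one
    (Eventually.of_forall fun k => (hpos k).ne') ?_).tendsto_atTop_zero
  simpa only [hratio] using hlim

variable {P : LurothData} {C Q γ : ℝ} {m ℓ ℓ' : ℕ → ℕ} {x x' y y' : ℕ → ℝ}

lemma IsCoding.prod_a_le (hm : P.IsBlockSeq Q m) (hγ : 0 ≤ γ) (hC : 0 < C)
    (ha : ∀ n, 1 ≤ n → P.a n ≤ C * P.t n ^ γ) (h : P.IsCoding m ℓ x y) (k : ℕ) :
    ∏ i ∈ Finset.range k, P.a (ℓ i) ≤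
      ∏ i ∈ Finset.range k, C * ((Q ^ (i + 1))⁻¹) ^ γ := by
  have hℓ : ∀ i, 1 ≤ ℓ i := fun i => (hm.one_le i).trans (h.mem_block i).1
  refine Finset.prod_le_prod (fun i _ => (P.pos _ (hℓ i)).le) fun i _ => ?_
  refine (ha _ (hℓ i)).trans (mul_le_mul_of_nonneg_left ?_ hC.le)
  exact Real.rpow_le_rpow (P.t_pos (hℓ i)).le
    ((P.t_anti (hm.one_le i) (h.mem_block i).1).trans (hm.t_le i)) hγ

lemma IsBlockSeq.exists_abs_sub_le (hm : P.IsBlockSeq Q m) (hC : 0 < C) {s : ℝ}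
    (hγs : 1 < γ * (1 - s)) (hγ : 1 < γ)
    (ha : ∀ n, 1 ≤ n → P.a n ≤ C * P.t n ^ γ) :
    ∃ K : ℝ, 0 ≤ K ∧ ∀ ℓ ℓ' x x' y y', P.IsCoding m ℓ x y → P.IsCoding m ℓ' x' y' →
      |y 0 - y' 0| ≤ K * |x 0 - x' 0| ^ s := by
  have hQ := hm.two_le
  have hs1 : s < 1 := by nlinarith
  obtain ⟨K, hK⟩ := (codingBound_tendsto hC hQ hγs).bddAbove_range
  refine ⟨max K 0, le_max_right _ _, fun ℓ ℓ' x x' y y' h h' => ?_⟩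
  have hapos : ∀ k, 0 ≤ ∏ i ∈ Finset.range k, P.a (ℓ i) := fun k =>
    Finset.prod_nonneg fun i _ => (P.pos _ ((hm.one_le i).trans (h.mem_block i).1)).le
  by_cases hne : ∃ k, ℓ k ≠ ℓ' k
  · classical
    obtain ⟨k, hk, hmin⟩ : ∃ k, ℓ k ≠ ℓ' k ∧ ∀ i < k, ℓ i = ℓ' i :=
      ⟨Nat.find hne, Nat.find_spec hne, fun i hi => not_not.1 (Nat.find_min hne hi)⟩
    obtain ⟨h1, h2⟩ := h.abs_sub_eq h' hm k hmin
    have h3 := h.abs_sub_le_of_ne h' hm hk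
    have h4 : (∏ i ∈ Finset.range (k + 1), (P.t (m i) - P.t (m (i + 1)))) * |y 0 - y' 0| ≤
        Q ^ (k + 4) * |x 0 - x' 0| := by
      rw [Finset.prod_range_succ, h1]
      calc _ = (P.t (m k) - P.t (m (k + 1))) *
            ((∏ i ∈ Finset.range k, (P.t (m i) - P.t (m (i + 1)))) * |y 0 - y' 0|) := by ring
        _ = (∏ i ∈ Finset.range k, P.a (ℓ i)) *
            ((P.t (m k) - P.t (m (k + 1))) * |y k - y' k|) := by rw [h2]; ring
        _ ≤ (∏ i ∈ Finset.range k, P.a (ℓ i)) * (Q ^ (k + 4) * |x k - x' k|) :=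
            mul_le_mul_of_nonneg_left h3 (hapos k)
        _ = _ := by ring
    have hB : 0 ≤ ∏ i ∈ Finset.range (k + 1), Q ^ (i + 2) :=
      Finset.prod_nonneg fun i _ => by positivity
    have h5 : |y 0 - y' 0| ≤
        (Q ^ (k + 4) * ∏ i ∈ Finset.range (k + 1), Q ^ (i + 2)) * |x 0 - x' 0| := by
      calc |y 0 - y' 0| ≤ ((∏ i ∈ Finset.range (k + 1), Q ^ (i + 2)) *
            ∏ i ∈ Finset.range (k + 1), (P.t (m i) - P.t (m (i + 1)))) * |y 0 - y' 0| :=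
            le_mul_of_one_le_left (abs_nonneg _) (hm.le_prod _)
        _ = (∏ i ∈ Finset.range (k + 1), Q ^ (i + 2)) *
            ((∏ i ∈ Finset.range (k + 1), (P.t (m i) - P.t (m (i + 1)))) * |y 0 - y' 0|) := by
            ring
        _ ≤ (∏ i ∈ Finset.range (k + 1), Q ^ (i + 2)) * (Q ^ (k + 4) * |x 0 - x' 0|) :=
            mul_le_mul_of_nonneg_left h4 hB
        _ = _ := by ring
    have h6 : |x 0 - x' 0| ≤ ∏ i ∈ Finset.range k, C * ((Q ^ (i + 1))⁻¹) ^ γ := by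
      rw [h1]
      refine le_trans (mul_le_of_le_one_right (hapos k) ?_)
        (h.prod_a_le hm (by linarith) hC ha k)
      exact abs_sub_le_of_nonneg_of_le (h.x_mem k).1 (h.x_mem k).2 (h'.x_mem k).1 (h'.x_mem k).2
    have h7 : |x 0 - x' 0| = |x 0 - x' 0| ^ (1 - s) * |x 0 - x' 0| ^ s := by
      rw [← Real.rpow_add' (abs_nonneg _) (by simp), sub_add_cancel, Real.rpow_one]
    rw [h7, ← mul_assoc] at h5
    refine h5.trans (mul_le_mul_of_nonneg_right ?_ (Real.rpow_nonneg (abs_nonneg _) _))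
    refine le_trans ?_ ((hK ⟨k, rfl⟩).trans (le_max_left _ _))
    rw [codingBound, mul_comm]
    refine mul_le_mul_of_nonneg_right ?_ (mul_nonneg (by positivity) hB)
    exact Real.rpow_le_rpow (abs_nonneg _) h6 (by linarith)
  · push Not at hne
    have hle : ∀ k, |y 0 - y' 0| ≤ codingBound C Q γ 1 k := fun k => by
      obtain ⟨-, h2⟩ := h.abs_sub_eq h' hm k fun i _ => hne i
      have hB : 0 ≤ ∏ i ∈ Finset.range k, Q ^ (i + 2) :=
        Finset.prod_nonneg fun i _ => by positivity
      have hA := h.prod_a_le hm (by linarith) hC ha k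
      have h3 : |y k - y' k| ≤ 1 :=
        abs_sub_le_of_nonneg_of_le (h.y_mem k).1 (h.y_mem k).2 (h'.y_mem k).1 (h'.y_mem k).2
      have hQ1 : 1 ≤ Q ^ (k + 4) * Q ^ (k + 2) :=
        one_le_mul_of_one_le_of_one_le (one_le_pow₀ (by linarith)) (one_le_pow₀ (by linarith))
      rw [codingBound, Real.rpow_one, Finset.prod_range_succ _ k]
      calc |y 0 - y' 0| ≤ ((∏ i ∈ Finset.range k, Q ^ (i + 2)) *
            ∏ i ∈ Finset.range k, (P.t (m i) - P.t (m (i + 1)))) * |y 0 - y' 0| :=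
            le_mul_of_one_le_left (abs_nonneg _) (hm.le_prod _)
        _ = (∏ i ∈ Finset.range k, Q ^ (i + 2)) *
            ((∏ i ∈ Finset.range k, P.a (ℓ i)) * |y k - y' k|) := by rw [← h2]; ring
        _ ≤ (∏ i ∈ Finset.range k, Q ^ (i + 2)) *
            ((∏ i ∈ Finset.range k, P.a (ℓ i)) * 1) := by
            have := hapos k
            gcongr
        _ ≤ (∏ i ∈ Finset.range k, Q ^ (i + 2)) *
            (∏ i ∈ Finset.range k, C * ((Q ^ (i + 1))⁻¹) ^ γ) := by
            rw [mul_one]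
            exact mul_le_mul_of_nonneg_left hA hB
        _ ≤ ((∏ i ∈ Finset.range k, Q ^ (i + 2)) *
            (∏ i ∈ Finset.range k, C * ((Q ^ (i + 1))⁻¹) ^ γ)) *
              (Q ^ (k + 4) * Q ^ (k + 2)) :=
            le_mul_of_one_le_right (mul_nonneg hB ((hapos k).trans hA)) hQ1
        _ = _ := by ring
    have h0 := ge_of_tendsto' (codingBound_tendsto hC hQ (by linarith)) hle
    exact h0.trans (mul_nonneg (le_max_right _ _) (Real.rpow_nonneg (abs_nonneg _) _))

end Estimate

end LurothData

namespace LurothData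

section LowerBound

variable {P : LurothData} {θ : ℝ}

lemma exists_a_le_mul_t_rpow (hexp : P.Expansive θ) (hdec : P.EventuallyDecreasing) {η : ℝ}
    (hη : θ < η) (hη0 : 0 < η) :
    ∃ C : ℝ, 0 < C ∧ ∀ n, 1 ≤ n → P.a n ≤ C * P.t n ^ (1 + 1 / η) := by
  obtain ⟨C, hC0, hC⟩ := hdec.exists_a_mul_le hexp
  obtain ⟨c, hc0, hc⟩ := hexp.exists_lower hη hη0
  refine ⟨C * c⁻¹ ^ (1 / η), by positivity, fun n hn => ?_⟩
  have hn' : (0 : ℝ) < n := by exact_mod_cast hn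
  have ht := P.t_pos hn
  have h1 : (n : ℝ)⁻¹ ≤ c⁻¹ ^ (1 / η) * P.t n ^ (1 / η) := by
    rw [← Real.mul_rpow (by positivity) ht.le]
    calc (n : ℝ)⁻¹ = ((n : ℝ) ^ (-η)) ^ (1 / η) := by
          rw [← Real.rpow_mul hn'.le, neg_mul, mul_one_div_cancel hη0.ne', Real.rpow_neg_one]
      _ ≤ _ := by
          refine Real.rpow_le_rpow (by positivity) ?_ (by positivity)
          rw [le_inv_mul_iff₀ hc0]
          exact hc n hn
  calc P.a n = P.a n * n * (n : ℝ)⁻¹ := by field_simp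
    _ ≤ C * P.t n * (n : ℝ)⁻¹ := mul_le_mul_of_nonneg_right (hC n hn) (by positivity)
    _ ≤ C * P.t n * (c⁻¹ ^ (1 / η) * P.t n ^ (1 / η)) :=
      mul_le_mul_of_nonneg_left h1 (by positivity)
    _ = _ := by
      rw [Real.rpow_add ht, Real.rpow_one]
      ring

lemma le_dimH_Finf_of_abs_sub_le {Q : ℝ} {m : ℕ → ℕ} (hm : P.IsBlockSeq Q m) {s : NNReal}
    (hs : 0 < s) {K : ℝ} (hK0 : 0 ≤ K)
    (hK : ∀ ℓ ℓ' x x' y y', P.IsCoding m ℓ x y → P.IsCoding m ℓ' x' y' →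
      |y 0 - y' 0| ≤ K * |x 0 - x' 0| ^ (s : ℝ)) :
    (s : ENNReal) ≤ dimH P.Finf := by
  have hs' : (0 : ℝ) < s := NNReal.coe_pos.2 hs
  have hf : ∀ p : ℝ, ∃ q : ℝ, (∃ ℓ x y, P.IsCoding m ℓ x y ∧ x 0 = p) →
      ∃ ℓ x y, P.IsCoding m ℓ x y ∧ x 0 = p ∧ y 0 = q := fun p => by
    by_cases h : ∃ ℓ x y, P.IsCoding m ℓ x y ∧ x 0 = p
    · obtain ⟨ℓ, x, y, h1, h2⟩ := h
      exact ⟨y 0, fun _ => ⟨ℓ, x, y, h1, h2, rfl⟩⟩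
    · exact ⟨0, fun h' => absurd h' h⟩
  choose f hf using hf
  set E : Set ℝ := {p | ∃ ℓ x y, P.IsCoding m ℓ x y ∧ x 0 = p}
  have hEF : E ⊆ P.Finf := by
    rintro p ⟨ℓ, x, y, h, rfl⟩
    exact h.mem_Finf hm
  have hhol : HolderOnWith K.toNNReal s f E := by
    intro p hp p' hp'
    obtain ⟨ℓ, x, y, h, rfl, hy⟩ := hf p hp
    obtain ⟨ℓ', x', y', h', rfl, hy'⟩ := hf p' hp'
    rw [← hy, ← hy', edist_dist, edist_dist, Real.dist_eq, Real.dist_eq,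
      ENNReal.ofReal_rpow_of_nonneg (abs_nonneg _) hs'.le]
    change _ ≤ ENNReal.ofReal K * _
    rw [← ENNReal.ofReal_mul hK0]
    exact ENNReal.ofReal_le_ofReal (hK _ _ _ _ _ _ h h')
  have hsurj : Icc (0 : ℝ) 1 ⊆ f '' E := by
    intro q hq
    obtain ⟨ℓ, x, y, h, rfl⟩ := hm.exists_isCoding hq
    have hx : x 0 ∈ E := ⟨ℓ, x, y, h, rfl⟩
    refine ⟨x 0, hx, ?_⟩
    obtain ⟨ℓ', x', y', h', hx', hy'⟩ := hf _ hx
    have h1 := hK _ _ _ _ _ _ h' h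
    rw [hx', sub_self, abs_zero, Real.zero_rpow hs'.ne', mul_zero, hy'] at h1
    exact sub_eq_zero.1 (abs_nonpos_iff.1 h1)
  have h1 : dimH (Icc (0 : ℝ) 1) = 1 := by
    rw [Real.dimH_of_nonempty_interior (by simp)]
    simp
  have h2 := (dimH_mono hsurj).trans (hhol.dimH_image_le hs)
  rw [h1, ENNReal.le_div_iff_mul_le (Or.inl (by exact_mod_cast hs.ne'))
    (Or.inl ENNReal.coe_ne_top), one_mul] at h2
  exact h2.trans (dimH_mono hEF)

theorem le_dimH_Finf (hθ : 0 ≤ θ) (hexp : P.Expansive θ) (hdec : P.EventuallyDecreasing) :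
    ENNReal.ofReal (1 / (1 + θ)) ≤ dimH P.Finf := by
  refine le_of_forall_lt fun d hd => ?_
  obtain ⟨s, hs1, hs2⟩ := ENNReal.lt_iff_exists_nnreal_btwn.1 hd
  refine hs1.trans_le ?_
  have hs0 : 0 < s := by exact_mod_cast (zero_le (a := d)).trans_lt hs1
  have hs0' : (0 : ℝ) < s := NNReal.coe_pos.2 hs0
  rw [ENNReal.coe_lt_ofReal, lt_div_iff₀ (by positivity)] at hs2
  obtain ⟨η, hη, hη'⟩ := exists_between (show θ < 1 / (s : ℝ) - 1 by
    rw [lt_sub_iff_add_lt, lt_div_iff₀ hs0']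
    linarith)
  rw [lt_sub_iff_add_lt, lt_div_iff₀ hs0'] at hη'
  have hη0 : 0 < η := hθ.trans_lt hη
  obtain ⟨C, hC0, hC⟩ := exists_a_le_mul_t_rpow hexp hdec hη hη0
  obtain ⟨Q, m, hm⟩ := hexp.exists_isBlockSeq
  have hγ : 1 < 1 + 1 / η := lt_add_of_pos_right _ (by positivity)
  have hγs : 1 < (1 + 1 / η) * (1 - (s : ℝ)) := by
    have : 1 + 1 / η = (η + 1) / η := by field_simp
    rw [this, div_mul_eq_mul_div, lt_div_iff₀ hη0]
    linarith
  obtain ⟨K, hK0, hK⟩ := hm.exists_abs_sub_le hC0 hγs hγ hC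
  exact le_dimH_Finf_of_abs_sub_le hm hs0 hK0 hK

end LowerBound

end LurothData

theorem dimension_Finf_Ginf (P : LurothData) (θ : ℝ) (hθ : 0 ≤ θ)
    (hexp : P.Expansive θ) (hdec : P.EventuallyDecreasing) :
    dimH P.Finf = ENNReal.ofReal (1 / (1 + θ)) ∧
    dimH P.Ginf = ENNReal.ofReal (1 / (1 + θ)) := by
  have h1 := LurothData.le_dimH_Finf hθ hexp hdec
  have h2 := LurothData.dimH_Ginf_le hθ hexp hdec
  have h3 : dimH P.Finf ≤ dimH P.Ginf := dimH_mono fun _ hx => hx.1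
  exact ⟨(h3.trans h2).antisymm h1, h2.antisymm (h1.trans h3)⟩
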